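/- Assume lim_{N→∞} d_U(A_N, A) = 0. Then for every function f : ℝ^r → ℝ of class C³ and every t ≥ 0, lim_{N→∞} sup_{p ∈ K_N} | N·(U_{N,[Nt]} f(p) − f(p)) − (G_A(t) f(p) + G_B f(p)) | = 0. -/

import Mathlib

open scoped BigOperators NNReal
open Finset MeasureTheory

noncomputable section

/-- A Q-matrix: nonnegative off-diagonal entries, rows summing to zero. -/
def IsQMatrix {r : ℕ} (M : Matrix (Fin r) (Fin r) ℝ) : Prop :=
  (∀ i j, i ≠ j → 0 ≤ M i j) ∧ ∀ i, ∑ j, M i j = 0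

/-- A stochastic matrix: nonnegative entries, rows summing to one. -/
def IsStochastic {r : ℕ} (M : Matrix (Fin r) (Fin r) ℝ) : Prop :=
  (∀ i j, 0 ≤ M i j) ∧ ∀ i, ∑ j, M i j = 1

/-- Frobenius norm of an `r×r` real matrix. -/
def frobNorm {r : ℕ} (M : Matrix (Fin r) (Fin r) ℝ) : ℝ :=
  Real.sqrt (∑ i, ∑ j, (M i j) ^ 2)

/-- The metric `d_U(x,y) = ∫₀^∞ e^{-u} sup_{0≤t≤u} (‖x(t)−y(t)‖ ∧ 1) du` on
matrix-valued paths. -/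
def dU {r : ℕ} (x y : ℝ → Matrix (Fin r) (Fin r) ℝ) : ℝ :=
  ∫ u in Set.Ioi (0 : ℝ),
    Real.exp (-u) * sSup ((fun t => min (frobNorm (x t - y t)) 1) '' Set.Icc 0 u)

/-- Multinomial probability weight `(∑β)!/∏ β_j! · ∏ p_j^{β_j}`. -/
def multinomialWeight {r : ℕ} (p : Fin r → ℝ) (β : Fin r → ℕ) : ℝ :=
  (Nat.multinomial Finset.univ β : ℝ) * ∏ j, p j ^ β j

/-- The internal-dynamics transition operator: `SOp N P f n = S_{N} f(n/N)`, where each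
of the `n i` agents of type `i` independently moves to type `j` with probability `P i j`,
the sum running over all arrays `ξ ∈ ℤ₊^{r×r}` whose `i`-th row sums to `n i`. -/
def SOp {r : ℕ} (N : ℕ) (P : Matrix (Fin r) (Fin r) ℝ) (f : (Fin r → ℝ) → ℝ)
    (n : Fin r → ℕ) : ℝ :=
  ∑ ξ ∈ Fintype.piFinset fun i => Finset.Nat.antidiagonalTuple r (n i),
    (∏ i, multinomialWeight (P i) (ξ i)) * f fun j => ((∑ i, ξ i j : ℕ) : ℝ) / N

/-- The multinomial-sampling operator `T_N f(p) = E[f(M/N)]`, `M ~ multinomial(N,p)`. -/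
def TOp {r : ℕ} (N : ℕ) (f : (Fin r → ℝ) → ℝ) (p : Fin r → ℝ) : ℝ :=
  ∑ α ∈ Finset.Nat.antidiagonalTuple r N,
    multinomialWeight p α * f fun i => (α i : ℝ) / N

/-- One-step operator of internal dynamics followed by multinomial sampling:
`U_{N,k} f = S_{N,k}(T_N f)`. -/
def UOp {r : ℕ} (N : ℕ) (P : Matrix (Fin r) (Fin r) ℝ) (f : (Fin r → ℝ) → ℝ)
    (n : Fin r → ℕ) : ℝ :=
  SOp N P (TOp N f) n

/-- The first-order generator `G_A(t) f(p) = ∑_{i,j} pᵢ aᵢⱼ(t) ∂f/∂xⱼ(p)`,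
here taking the matrix `A(t)` as argument. -/
def GA {r : ℕ} (M : Matrix (Fin r) (Fin r) ℝ) (f : (Fin r → ℝ) → ℝ) (p : Fin r → ℝ) : ℝ :=
  ∑ i, ∑ j, p i * M i j * fderiv ℝ f p (Pi.single j 1)

/-- The Wright–Fisher generator
`G_B f(p) = (1/2) ∑_{i,j} pᵢ(δᵢⱼ − pⱼ) ∂²f/∂xᵢ∂xⱼ(p)`. -/
def GB {r : ℕ} (f : (Fin r → ℝ) → ℝ) (p : Fin r → ℝ) : ℝ :=
  (1 / 2) * ∑ i, ∑ j,
    p i * ((if i = j then (1 : ℝ) else 0) - p j) *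
      fderiv ℝ (fun x => fderiv ℝ f x (Pi.single j 1)) p (Pi.single i 1)

open Filter Topology

lemma multinomialWeight_nonneg {r : ℕ} {q : Fin r → ℝ} (hq : ∀ j, 0 ≤ q j) (β : Fin r → ℕ) :
    0 ≤ multinomialWeight q β :=
  mul_nonneg (Nat.cast_nonneg _) (prod_nonneg fun j _ => pow_nonneg (hq j) _)

lemma multinomialWeight_add_single {r : ℕ} (q : Fin r → ℝ) (α : Fin r → ℕ) (k : Fin r) :
    ((α k : ℝ) + 1) * multinomialWeight q (α + Pi.single k 1)
      = ((∑ i, α i : ℕ) + 1 : ℝ) * q k * multinomialWeight q α := by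
  have hupd : α + Pi.single k 1 = Function.update α k (α k + 1) := by
    ext i
    by_cases h : i = k
    · subst h; simp
    · simp [h]
  have hprod : ∏ j, q j ^ (α + Pi.single k 1 : Fin r → ℕ) j = q k * ∏ j, q j ^ α j := by
    simp only [Pi.add_apply, pow_add, prod_mul_distrib]
    rw [mul_comm]
    congr 1
    rw [prod_eq_single k] <;> simp +contextual
  have hfact : ∏ j, ((α + Pi.single k 1 : Fin r → ℕ) j).factorial = (α k + 1) * ∏ j, (α j).factorial := by
    rw [hupd, ← mul_prod_erase univ _ (mem_univ k), ← mul_prod_erase univ _ (mem_univ k),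
      Function.update_self, Nat.factorial_succ, mul_assoc]
    congr 2
    refine prod_congr rfl fun j hj => ?_
    rw [Function.update_of_ne (ne_of_mem_erase hj)]
  have hsum : ∑ j, (α + Pi.single k 1 : Fin r → ℕ) j = ∑ j, α j + 1 := by
    simp [sum_add_distrib]
  have h1 := Nat.multinomial_spec univ (α + Pi.single k 1)
  have h2 := Nat.multinomial_spec univ α
  rw [hfact, hsum, Nat.factorial_succ, ← h2] at h1
  have hpos : (∏ j, (α j).factorial) ≠ 0 := prod_ne_zero_iff.2 fun j _ => Nat.factorial_ne_zero _
  have h3 : (α k + 1) * Nat.multinomial univ (α + Pi.single k 1)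
      = (∑ j, α j + 1) * Nat.multinomial univ α :=
    mul_left_cancel₀ hpos (by linarith)
  have h4 : ((α k : ℝ) + 1) * Nat.multinomial univ (α + Pi.single k 1)
      = ((∑ j, α j : ℕ) + 1) * Nat.multinomial univ α := by exact_mod_cast h3
  unfold multinomialWeight
  rw [hprod, ← mul_assoc, h4]
  ring

/-- Expectation of `g` under the multinomial distribution with parameters `n` and `q`. -/
def multinomialExp {r : ℕ} (q : Fin r → ℝ) (n : ℕ) (g : (Fin r → ℕ) → ℝ) : ℝ :=
  ∑ α ∈ Finset.Nat.antidiagonalTuple r n, multinomialWeight q α * g α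

lemma multinomialExp_add {r : ℕ} (q : Fin r → ℝ) (n : ℕ) (g h : (Fin r → ℕ) → ℝ) :
    multinomialExp q n (fun α => g α + h α) = multinomialExp q n g + multinomialExp q n h := by
  simp only [multinomialExp, mul_add, sum_add_distrib]

lemma multinomialExp_const_mul {r : ℕ} (q : Fin r → ℝ) (n : ℕ) (c : ℝ) (g : (Fin r → ℕ) → ℝ) :
    multinomialExp q n (fun α => c * g α) = c * multinomialExp q n g := by
  simp only [multinomialExp, mul_sum]
  exact sum_congr rfl fun _ _ => by ring

lemma multinomialExp_sum {r : ℕ} {ι : Type*} (s : Finset ι) (q : Fin r → ℝ) (n : ℕ)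
    (g : ι → (Fin r → ℕ) → ℝ) :
    multinomialExp q n (fun α => ∑ k ∈ s, g k α) = ∑ k ∈ s, multinomialExp q n (g k) := by
  simp only [multinomialExp, mul_sum]
  exact sum_comm

lemma multinomialExp_mono {r : ℕ} {q : Fin r → ℝ} (hq : ∀ j, 0 ≤ q j) {n : ℕ}
    {g h : (Fin r → ℕ) → ℝ} (hgh : ∀ α, ∑ i, α i = n → g α ≤ h α) :
    multinomialExp q n g ≤ multinomialExp q n h :=
  sum_le_sum fun α hα => mul_le_mul_of_nonneg_left
    (hgh α (Finset.Nat.mem_antidiagonalTuple.1 hα)) (multinomialWeight_nonneg hq α)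

lemma multinomialExp_succ {r : ℕ} (q : Fin r → ℝ) (n : ℕ) (g : (Fin r → ℕ) → ℝ) :
    multinomialExp q (n + 1) g
      = multinomialExp q n (fun α => ∑ k, q k * g (α + Pi.single k 1)) := by
  have key : ∀ k, ∑ β ∈ Finset.Nat.antidiagonalTuple r (n + 1),
      (β k : ℝ) * (multinomialWeight q β * g β)
      = (n + 1 : ℝ) * ∑ α ∈ Finset.Nat.antidiagonalTuple r n,
          multinomialWeight q α * (q k * g (α + Pi.single k 1)) := by
    intro k
    rw [mul_sum]
    symm
    refine sum_of_injOn (fun α => α + Pi.single k 1) (fun a _ b _ h => by simpa using h) ?_ ?_ ?_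
    · intro α hα
      have := Finset.Nat.mem_antidiagonalTuple.1 (Finset.mem_coe.1 hα)
      refine Finset.mem_coe.2 (Finset.Nat.mem_antidiagonalTuple.2 ?_)
      simp [sum_add_distrib, this]
    · intro β hβ hβ'
      have hβs := Finset.Nat.mem_antidiagonalTuple.1 hβ
      have : β k = 0 := by
        by_contra h0
        have hle : Pi.single k 1 ≤ β := by
          intro i
          by_cases h : i = k
          · subst h; simpa using Nat.one_le_iff_ne_zero.2 h0
          · simp [h]
        refine hβ' ⟨β - Pi.single k 1, ?_, ?_⟩
        · refine Finset.mem_coe.2 (Finset.Nat.mem_antidiagonalTuple.2 ?_)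
          have h1 : ∑ i, ((β - Pi.single k 1 : Fin r → ℕ) i + (Pi.single k 1 : Fin r → ℕ) i) = n + 1 := by
            rw [← hβs]
            exact sum_congr rfl fun i _ => Nat.sub_add_cancel (hle i)
          rw [sum_add_distrib] at h1
          simpa using h1
        · exact tsub_add_cancel_of_le hle
      simp [this]
    · intro α hα
      have hs := Finset.Nat.mem_antidiagonalTuple.1 hα
      have := multinomialWeight_add_single q α k
      rw [hs] at this
      simp only [Pi.add_apply, Pi.single_eq_same, Nat.cast_add, Nat.cast_one]
      linear_combination -g (α + Pi.single k 1) * this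
  have hn : (n + 1 : ℝ) ≠ 0 := by positivity
  refine mul_left_cancel₀ hn ?_
  simp only [multinomialExp, mul_sum univ]
  rw [sum_comm (t := univ), mul_sum univ, ← sum_congr rfl fun k _ => key k, sum_comm, mul_sum]
  refine sum_congr rfl fun β hβ => ?_
  rw [← sum_mul, ← Nat.cast_sum, Finset.Nat.mem_antidiagonalTuple.1 hβ]
  push_cast; ring

lemma multinomialExp_zero {r : ℕ} (q : Fin r → ℝ) (g : (Fin r → ℕ) → ℝ) :
    multinomialExp q 0 g = g 0 := by
  simp [multinomialExp, multinomialWeight, Finset.Nat.antidiagonalTuple_zero_right,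
    Nat.multinomial]

lemma multinomialExp_const {r : ℕ} {q : Fin r → ℝ} (hq : ∑ j, q j = 1) (n : ℕ) (c : ℝ) :
    multinomialExp q n (fun _ => c) = c := by
  induction n with
  | zero => rw [multinomialExp_zero]
  | succ n ih => rw [multinomialExp_succ]; simp only [← sum_mul, hq, one_mul, ih]

/-- The deviation of the `j`-th coordinate from its multinomial mean. -/
def dev {r : ℕ} (q : Fin r → ℝ) (n : ℕ) (j : Fin r) (α : Fin r → ℕ) : ℝ := α j - n * q j

lemma dev_add_single {r : ℕ} (q : Fin r → ℝ) (n : ℕ) (j k : Fin r) (α : Fin r → ℕ) :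
    dev q (n + 1) j (α + Pi.single k 1) = dev q n j α + ((if k = j then 1 else 0) - q j) := by
  unfold dev
  by_cases h : k = j
  · subst h; simp; ring
  · simp [h, Ne.symm h]; ring

/-- Averaging a function of an indicator over a probability vector. -/
lemma sum_mul_apply_ite {r : ℕ} {q : Fin r → ℝ} (hq : ∑ j, q j = 1) (j : Fin r) (F : ℝ → ℝ) :
    ∑ k, q k * F (if k = j then 1 else 0) = q j * F 1 + (1 - q j) * F 0 := by
  have : ∀ k, q k * F (if k = j then 1 else 0)
      = q k * F 0 + if k = j then q k * (F 1 - F 0) else 0 := by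
    intro k; split_ifs <;> ring
  simp only [this, sum_add_distrib, ← sum_mul, hq, sum_ite_eq', mem_univ, if_true]
  ring

lemma multinomialExp_dev {r : ℕ} {q : Fin r → ℝ} (hq : ∑ j, q j = 1) (n : ℕ) (j : Fin r) :
    multinomialExp q n (dev q n j) = 0 := by
  induction n with
  | zero => rw [multinomialExp_zero]; simp [dev]
  | succ n ih =>
    rw [multinomialExp_succ]
    simp only [dev_add_single]
    refine Eq.trans (congrArg _ (funext fun α => ?_)) ih
    rw [sum_mul_apply_ite hq j fun x => dev q n j α + (x - q j)]
    ring

lemma multinomialExp_dev_mul_dev {r : ℕ} {q : Fin r → ℝ} (hq : ∑ j, q j = 1) (n : ℕ)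
    (i j : Fin r) :
    multinomialExp q n (fun α => dev q n i α * dev q n j α)
      = n * (q i * ((if i = j then 1 else 0) - q j)) := by
  induction n with
  | zero => rw [multinomialExp_zero]; simp [dev]
  | succ n ih =>
    rw [multinomialExp_succ]
    simp only [dev_add_single]
    have : ∀ α : Fin r → ℕ, ∑ k, q k * ((dev q n i α + ((if k = i then 1 else 0) - q i)) *
        (dev q n j α + ((if k = j then 1 else 0) - q j)))
        = dev q n i α * dev q n j α + q i * ((if i = j then 1 else 0) - q j) := by
      intro α
      have : ∀ k, q k * ((dev q n i α + ((if k = i then 1 else 0) - q i)) *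
        (dev q n j α + ((if k = j then 1 else 0) - q j)))
        = q k * ((dev q n i α - q i) * (dev q n j α - q j + (if k = j then 1 else 0)))
          + if k = i then q k * (dev q n j α - q j + (if k = j then 1 else 0)) else 0 := by
        intro k; split_ifs <;> ring
      simp only [this, sum_add_distrib, sum_ite_eq', mem_univ, if_true]
      rw [sum_mul_apply_ite hq j fun x => (dev q n i α - q i) * (dev q n j α - q j + x)]
      ring
    simp only [this]
    rw [multinomialExp_add, ih, multinomialExp_const hq]
    push_cast; ring

lemma multinomialExp_dev_pow_four_le {r : ℕ} {q : Fin r → ℝ} (hq0 : ∀ j, 0 ≤ q j)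
    (hq : ∑ j, q j = 1) (n : ℕ) (j : Fin r) :
    multinomialExp q n (fun α => dev q n j α ^ 4) ≤ 11 * (n : ℝ) ^ 2 := by
  have ha0 := hq0 j
  have ha1 : q j ≤ 1 := hq ▸ single_le_sum (fun i _ => hq0 i) (mem_univ j)
  induction n with
  | zero => rw [multinomialExp_zero]; simp [dev]
  | succ n ih =>
    rw [multinomialExp_succ]
    simp only [dev_add_single]
    have h1 : multinomialExp q n
        (fun α => ∑ k, q k * (dev q n j α + ((if k = j then 1 else 0) - q j)) ^ 4)
        ≤ multinomialExp q n
          (fun α => dev q n j α ^ 4 + (8 * (dev q n j α * dev q n j α) + 3)) := by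
      refine multinomialExp_mono hq0 fun α _ => ?_
      rw [sum_mul_apply_ite hq j fun x => (dev q n j α + (x - q j)) ^ 4]
      generalize dev q n j α = d
      generalize q j = a at ha0 ha1
      have hv0 : 0 ≤ a * (1 - a) := mul_nonneg ha0 (by linarith)
      have hv1 : a * (1 - a) ≤ 1 := by nlinarith
      have e : a * (d + (1 - a)) ^ 4 + (1 - a) * (d + (0 - a)) ^ 4
          = d ^ 4 + a * (1 - a) * (6 * d ^ 2 + 4 * d * (1 - 2 * a) + (1 - 3 * a + 3 * a ^ 2)) := by
        ring
      have hb : 6 * d ^ 2 + 4 * d * (1 - 2 * a) + (1 - 3 * a + 3 * a ^ 2) ≤ 8 * d ^ 2 + 3 := by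
        nlinarith [sq_nonneg (d - (1 - 2 * a))]
      have h2 : a * (1 - a) * (6 * d ^ 2 + 4 * d * (1 - 2 * a) + (1 - 3 * a + 3 * a ^ 2))
          ≤ 1 * (8 * d ^ 2 + 3) :=
        (mul_le_mul_of_nonneg_left hb hv0).trans
          (mul_le_mul_of_nonneg_right hv1 (by positivity))
      rw [e]; nlinarith
    refine h1.trans ?_
    rw [multinomialExp_add, multinomialExp_add, multinomialExp_const_mul,
      multinomialExp_dev_mul_dev hq, multinomialExp_const hq]
    simp only [if_true]
    have hv : q j * (1 - q j) ≤ 1 := by nlinarith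
    have hn : (0 : ℝ) ≤ n := Nat.cast_nonneg n
    have := mul_le_mul_of_nonneg_left hv hn
    push_cast
    nlinarith

/-- Expectation of `G` when the rows of `ξ` are independent, the `i`-th one being multinomial
with parameters `n i` and `P i`. -/
def rowExp {r : ℕ} (P : Matrix (Fin r) (Fin r) ℝ) (n : Fin r → ℕ)
    (G : (Fin r → Fin r → ℕ) → ℝ) : ℝ :=
  ∑ ξ ∈ Fintype.piFinset fun i => Finset.Nat.antidiagonalTuple r (n i),
    (∏ i, multinomialWeight (P i) (ξ i)) * G ξ

lemma rowExp_add {r : ℕ} (P : Matrix (Fin r) (Fin r) ℝ) (n : Fin r → ℕ)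
    (G H : (Fin r → Fin r → ℕ) → ℝ) :
    rowExp P n (fun ξ => G ξ + H ξ) = rowExp P n G + rowExp P n H := by
  simp only [rowExp, mul_add, sum_add_distrib]

lemma rowExp_const_mul {r : ℕ} (P : Matrix (Fin r) (Fin r) ℝ) (n : Fin r → ℕ) (c : ℝ)
    (G : (Fin r → Fin r → ℕ) → ℝ) :
    rowExp P n (fun ξ => c * G ξ) = c * rowExp P n G := by
  simp only [rowExp, mul_sum]
  exact sum_congr rfl fun _ _ => by ring

lemma rowExp_sum {r : ℕ} {ι : Type*} (s : Finset ι) (P : Matrix (Fin r) (Fin r) ℝ)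
    (n : Fin r → ℕ) (G : ι → (Fin r → Fin r → ℕ) → ℝ) :
    rowExp P n (fun ξ => ∑ k ∈ s, G k ξ) = ∑ k ∈ s, rowExp P n (G k) := by
  simp only [rowExp, mul_sum]
  exact sum_comm

lemma rowExp_mono {r : ℕ} {P : Matrix (Fin r) (Fin r) ℝ} (hP : ∀ i j, 0 ≤ P i j)
    {n : Fin r → ℕ} {G H : (Fin r → Fin r → ℕ) → ℝ}
    (hGH : ∀ ξ, (∀ i, ∑ j, ξ i j = n i) → G ξ ≤ H ξ) :
    rowExp P n G ≤ rowExp P n H :=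
  sum_le_sum fun ξ hξ => mul_le_mul_of_nonneg_left
    (hGH ξ fun i => Finset.Nat.mem_antidiagonalTuple.1 (Fintype.mem_piFinset.1 hξ i))
    (prod_nonneg fun i _ => multinomialWeight_nonneg (hP i) _)

lemma rowExp_prod {r : ℕ} (P : Matrix (Fin r) (Fin r) ℝ) (n : Fin r → ℕ)
    (g : Fin r → (Fin r → ℕ) → ℝ) :
    rowExp P n (fun ξ => ∏ i, g i (ξ i)) = ∏ i, multinomialExp (P i) (n i) (g i) := by
  simp only [rowExp, multinomialExp, prod_univ_sum, prod_mul_distrib]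

lemma rowExp_const {r : ℕ} {P : Matrix (Fin r) (Fin r) ℝ} (hP : ∀ i, ∑ j, P i j = 1)
    (n : Fin r → ℕ) (c : ℝ) : rowExp P n (fun _ => c) = c := by
  have := rowExp_prod P n fun _ _ => 1
  simp only [multinomialExp_const (hP _), prod_const_one] at this
  simpa [this] using rowExp_const_mul P n c fun _ => 1

lemma rowExp_row {r : ℕ} {P : Matrix (Fin r) (Fin r) ℝ} (hP : ∀ i, ∑ j, P i j = 1)
    (n : Fin r → ℕ) (i : Fin r) (g : (Fin r → ℕ) → ℝ) :
    rowExp P n (fun ξ => g (ξ i)) = multinomialExp (P i) (n i) g := by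
  have := rowExp_prod P n fun k α => if k = i then g α else 1
  simp only [prod_ite_eq', mem_univ, if_true] at this
  rw [this, prod_eq_single i]
  · simp
  · intro k _ hk; simp [hk, multinomialExp_const (hP k)]
  · simp

lemma rowExp_row_mul_row {r : ℕ} {P : Matrix (Fin r) (Fin r) ℝ}
    {n : Fin r → ℕ} {i i' : Fin r} (hi : i ≠ i') {g : (Fin r → ℕ) → ℝ} (h : (Fin r → ℕ) → ℝ)
    (hg : multinomialExp (P i) (n i) g = 0) :
    rowExp P n (fun ξ => g (ξ i) * h (ξ i')) = 0 := by
  have := rowExp_prod P n fun k α => (if k = i then g α else 1) * (if k = i' then h α else 1)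
  simp only [prod_mul_distrib, prod_ite_eq', mem_univ, if_true] at this
  rw [this, prod_eq_zero (mem_univ i)]
  simpa [hi] using hg

/-- The total deviation of the `j`-th coordinate from its mean, over all rows. -/
def totalDev {r : ℕ} (P : Matrix (Fin r) (Fin r) ℝ) (n : Fin r → ℕ) (j : Fin r)
    (ξ : Fin r → Fin r → ℕ) : ℝ := ∑ i, dev (P i) (n i) j (ξ i)

lemma rowExp_totalDev {r : ℕ} {P : Matrix (Fin r) (Fin r) ℝ} (hP : ∀ i, ∑ j, P i j = 1)
    (n : Fin r → ℕ) (j : Fin r) : rowExp P n (totalDev P n j) = 0 := by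
  unfold totalDev
  rw [rowExp_sum]
  refine sum_eq_zero fun i _ => ?_
  rw [rowExp_row hP n i, multinomialExp_dev (hP i)]

lemma rowExp_totalDev_sq {r : ℕ} {P : Matrix (Fin r) (Fin r) ℝ} (hP : ∀ i, ∑ j, P i j = 1)
    (n : Fin r → ℕ) (j : Fin r) :
    rowExp P n (fun ξ => totalDev P n j ξ ^ 2) = ∑ i, n i * (P i j * (1 - P i j)) := by
  simp only [totalDev, pow_two, sum_mul_sum]
  rw [rowExp_sum]
  refine sum_congr rfl fun i _ => ?_
  rw [rowExp_sum, sum_eq_single i]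
  · rw [rowExp_row hP n i fun α => dev (P i) (n i) j α * dev (P i) (n i) j α,
      multinomialExp_dev_mul_dev (hP i)]
    simp
  · intro i' _ hi'
    exact rowExp_row_mul_row hi'.symm (dev (P i') (n i') j) (multinomialExp_dev (hP i) _ _)
  · simp

lemma SOp_eq_rowExp {r : ℕ} (N : ℕ) (P : Matrix (Fin r) (Fin r) ℝ) (f : (Fin r → ℝ) → ℝ)
    (n : Fin r → ℕ) :
    SOp N P f n = rowExp P n fun ξ => f fun j => ((∑ i, ξ i j : ℕ) : ℝ) / N := rfl

lemma TOp_eq_multinomialExp {r : ℕ} (N : ℕ) (f : (Fin r → ℝ) → ℝ) (p : Fin r → ℝ) :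
    TOp N f p = multinomialExp p N fun α => f fun i => (α i : ℝ) / N := rfl

lemma exp_mul_min_frobNorm_le_dU {r : ℕ} (x y : ℝ → Matrix (Fin r) (Fin r) ℝ) {t : ℝ} (ht : 0 ≤ t) :
    Real.exp (-t) * min (frobNorm (x t - y t)) 1 ≤ dU x y := by
  set h : ℝ → ℝ := fun s => min (frobNorm (x s - y s)) 1 with hh
  set g : ℝ → ℝ := fun u => sSup (h '' Set.Icc 0 u) with hg
  have h0 : ∀ s, 0 ≤ h s := fun s => le_min (Real.sqrt_nonneg _) zero_le_one
  have hbdd : ∀ u, BddAbove (h '' Set.Icc 0 u) := fun u =>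
    ⟨1, by rintro _ ⟨s, _, rfl⟩; exact min_le_right _ _⟩
  have hg0 : ∀ u, 0 ≤ g u := fun u => Real.sSup_nonneg (by rintro _ ⟨s, _, rfl⟩; exact h0 s)
  have hg1 : ∀ u, g u ≤ 1 := fun u =>
    Real.sSup_le (by rintro _ ⟨s, _, rfl⟩; exact min_le_right _ _) zero_le_one
  have hmono : MonotoneOn g (Set.Ioi 0) := fun u hu v _ huv =>
    csSup_le_csSup (hbdd v) ⟨h 0, 0, ⟨le_rfl, le_of_lt hu⟩, rfl⟩
      (Set.image_mono (Set.Icc_subset_Icc_right huv))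
  have hint : IntegrableOn (fun u => Real.exp (-u) * g u) (Set.Ioi 0) := by
    refine Integrable.mono' (integrableOn_exp_neg_Ioi 0) ?_ (ae_of_all _ fun u => ?_)
    · exact ((Real.continuous_exp.comp continuous_neg).aestronglyMeasurable).mul
        (aemeasurable_restrict_of_monotoneOn measurableSet_Ioi hmono).aestronglyMeasurable
    · rw [Real.norm_eq_abs, abs_mul, abs_of_nonneg (Real.exp_pos _).le, abs_of_nonneg (hg0 u)]
      exact mul_le_of_le_one_right (Real.exp_pos _).le (hg1 u)
  have hsub : Set.Ioi t ⊆ Set.Ioi 0 := Set.Ioi_subset_Ioi ht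
  calc Real.exp (-t) * h t = ∫ u in Set.Ioi t, Real.exp (-u) * h t := by
        rw [integral_mul_const, integral_exp_neg_Ioi]
    _ ≤ ∫ u in Set.Ioi t, Real.exp (-u) * g u := by
        refine setIntegral_mono_on ((integrableOn_exp_neg_Ioi t).mul_const _)
          (hint.mono_set hsub) measurableSet_Ioi fun u hu => ?_
        exact mul_le_mul_of_nonneg_left
          (le_csSup (hbdd u) ⟨t, ⟨ht, le_of_lt hu⟩, rfl⟩) (Real.exp_pos _).le
    _ ≤ ∫ u in Set.Ioi 0, Real.exp (-u) * g u :=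
        setIntegral_mono_set hint
          (ae_of_all _ fun u => mul_nonneg (Real.exp_pos _).le (hg0 u))
          (Filter.Eventually.of_forall hsub)

lemma abs_apply_le_frobNorm {r : ℕ} (M : Matrix (Fin r) (Fin r) ℝ) (i j : Fin r) :
    |M i j| ≤ frobNorm M := by
  refine Real.abs_le_sqrt ?_
  calc M i j ^ 2 ≤ ∑ j', M i j' ^ 2 :=
        single_le_sum (f := fun j' => M i j' ^ 2) (fun _ _ => sq_nonneg _) (mem_univ j)
    _ ≤ _ := single_le_sum (f := fun i' => ∑ j', M i' j' ^ 2)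
        (fun _ _ => sum_nonneg fun _ _ => sq_nonneg _) (mem_univ i)

/-- Convergence in `dU` implies entrywise convergence at every time. -/
lemma eventually_abs_sub_lt_of_dU {r : ℕ} {A : ℕ → ℝ → Matrix (Fin r) (Fin r) ℝ}
    {Alim : ℝ → Matrix (Fin r) (Fin r) ℝ}
    (hconv : Tendsto (fun N => dU (A N) Alim) atTop (𝓝 0)) {t : ℝ} (ht : 0 ≤ t)
    {η : ℝ} (hη : 0 < η) :
    ∀ᶠ N in atTop, ∀ i j, |A N t i j - Alim t i j| < η := by
  have hpos : 0 < Real.exp (-t) * min η 1 := by positivity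
  filter_upwards [hconv.eventually (gt_mem_nhds hpos)] with N hN i j
  have h1 := (exp_mul_min_frobNorm_le_dU (A N) Alim ht).trans_lt hN
  have h2 := lt_of_mul_lt_mul_left h1 (Real.exp_pos _).le
  have h3 : frobNorm (A N t - Alim t) < η := by
    rcases min_lt_iff.1 h2 with h | h
    · exact h.trans_le (min_le_left _ _)
    · exact absurd h (not_lt.2 (min_le_right _ _))
  exact (abs_apply_le_frobNorm (A N t - Alim t) i j).trans_lt h3

/-- On a stepwise constant path, time `t` may be replaced by its grid point. -/
lemma stepwise_eq_floor {r N : ℕ} (hN : 1 ≤ N) {B : ℝ → Matrix (Fin r) (Fin r) ℝ}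
    (hB : ∀ k : ℕ, ∀ t : ℝ, (k : ℝ) / N ≤ t → t < ((k : ℝ) + 1) / N → B t = B ((k : ℝ) / N))
    {t : ℝ} (ht : 0 ≤ t) : B ((⌊(N : ℝ) * t⌋₊ : ℝ) / N) = B t := by
  have hN0 : (0 : ℝ) < N := by exact_mod_cast hN
  refine (hB _ t ?_ ?_).symm
  · rw [div_le_iff₀ hN0, mul_comm t]
    exact Nat.floor_le (by positivity)
  · rw [lt_div_iff₀ hN0, mul_comm t]
    exact Nat.lt_floor_add_one _

/-- The `j`-th partial derivative of `f`. -/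
def partialDeriv {r : ℕ} (j : Fin r) (f : (Fin r → ℝ) → ℝ) (x : Fin r → ℝ) : ℝ :=
  fderiv ℝ f x (Pi.single j 1)

lemma ContDiff.partialDeriv {r : ℕ} {f : (Fin r → ℝ) → ℝ} {m n : WithTop ℕ∞}
    (hf : ContDiff ℝ n f) (hmn : m + 1 ≤ n) (j : Fin r) : ContDiff ℝ m (partialDeriv j f) :=
  (hf.fderiv_right hmn).clm_apply contDiff_const

/-- The unit cube, a convex compact set containing the probability simplex. -/
def unitCube (r : ℕ) : Set (Fin r → ℝ) := Set.Icc 0 1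

lemma exists_lipschitz_unitCube {r : ℕ} {f : (Fin r → ℝ) → ℝ} (hf : ContDiff ℝ 1 f) :
    ∃ C : ℝ, 0 ≤ C ∧ ∀ x ∈ unitCube r, ∀ y ∈ unitCube r, |f y - f x| ≤ C * ‖y - x‖ := by
  obtain ⟨K, hK⟩ := hf.contDiffOn.exists_lipschitzOnWith one_ne_zero
    (convex_Icc (0 : Fin r → ℝ) 1) isCompact_Icc
  refine ⟨K, K.2, fun x hx y hy => ?_⟩
  simpa [Real.dist_eq, dist_eq_norm] using hK.dist_le_mul y hy x hx

lemma exists_bound_unitCube {r : ℕ} {f : (Fin r → ℝ) → ℝ} (hf : Continuous f) :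
    ∃ C : ℝ, 0 ≤ C ∧ ∀ x ∈ unitCube r, |f x| ≤ C := by
  obtain ⟨C, hC⟩ := (isCompact_Icc (a := (0 : Fin r → ℝ)) (b := 1)).exists_bound_of_continuousOn
    hf.continuousOn
  exact ⟨max C 0, le_max_right _ _, fun x hx => (hC x hx).trans (le_max_left _ _)⟩

lemma hasDerivAt_along_line {r : ℕ} {f : (Fin r → ℝ) → ℝ} (hf : Differentiable ℝ f)
    (x v : Fin r → ℝ) (s : ℝ) :
    HasDerivAt (fun s : ℝ => f (x + s • v)) (∑ j, v j * partialDeriv j f (x + s • v)) s := by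
  have h1 : HasDerivAt (fun s : ℝ => x + s • v) v s := by
    simpa using ((hasDerivAt_id s).smul_const v).const_add x
  have h2 := (hf (x + s • v)).hasFDerivAt.comp_hasDerivAt s h1
  have hv : v = ∑ j, v j • Pi.single j (1 : ℝ) := by
    ext i; simp [Finset.sum_apply, Pi.single_apply]
  have h3 : fderiv ℝ f (x + s • v) v = ∑ j, v j * partialDeriv j f (x + s • v) := by
    conv_lhs => arg 2; rw [hv]
    simp [partialDeriv, map_sum]
  rw [← h3]
  exact h2

lemma add_smul_sub_mem_unitCube {r : ℕ} {x y : Fin r → ℝ} (hx : x ∈ unitCube r)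
    (hy : y ∈ unitCube r) {s : ℝ} (hs0 : 0 ≤ s) (hs1 : s ≤ 1) : x + s • (y - x) ∈ unitCube r :=
  (convex_Icc (0 : Fin r → ℝ) 1).add_smul_sub_mem hx hy ⟨hs0, hs1⟩

lemma norm_smul_le_of_mem {r : ℕ} {v : Fin r → ℝ} {s : ℝ} (hs0 : 0 ≤ s) (hs1 : s ≤ 1) :
    ‖s • v‖ ≤ ‖v‖ := by
  rw [norm_smul, Real.norm_eq_abs, abs_of_nonneg hs0]
  exact mul_le_of_le_one_left (norm_nonneg _) hs1

/-- First-order Taylor estimate, uniform on the unit cube. -/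
lemma exists_taylor_one {r : ℕ} {f : (Fin r → ℝ) → ℝ} (hf : ContDiff ℝ 2 f) :
    ∃ C : ℝ, 0 ≤ C ∧ ∀ x ∈ unitCube r, ∀ y ∈ unitCube r,
      |f y - f x - ∑ j, (y j - x j) * partialDeriv j f x| ≤ C * ‖y - x‖ ^ 2 := by
  choose L hL0 hL using fun j =>
    exists_lipschitz_unitCube (hf.partialDeriv (m := 1) (by norm_num) j)
  refine ⟨∑ j, L j, sum_nonneg fun j _ => hL0 j, fun x hx y hy => ?_⟩
  set v := y - x with hv
  have key := norm_image_sub_le_of_norm_deriv_le_segment_01'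
    (f := fun s : ℝ => f (x + s • v) - s * ∑ j, v j * partialDeriv j f x)
    (f' := fun s => ∑ j, v j * partialDeriv j f (x + s • v) - ∑ j, v j * partialDeriv j f x)
    (C := (∑ j, L j) * ‖v‖ ^ 2)
    (fun s _ => ((hasDerivAt_along_line (hf.differentiable (by norm_num)) x v s).sub
      (by simpa using (hasDerivAt_id s).mul_const _)).hasDerivWithinAt)
    (fun s hs => ?_)
  · have e : x + (1 : ℝ) • v = y := by simp [hv]
    rw [e] at key
    convert key using 1
    rw [Real.norm_eq_abs]
    congr 1
    simp [hv]
    ring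
  · rw [← sum_sub_distrib, sum_mul]
    refine (norm_sum_le _ _).trans (sum_le_sum fun j _ => ?_)
    rw [← mul_sub, norm_mul, pow_two, mul_comm, ← mul_assoc]
    refine mul_le_mul ?_ (norm_le_pi_norm v j) (norm_nonneg _)
      (mul_nonneg (hL0 j) (norm_nonneg _))
    refine (hL j x hx _ (add_smul_sub_mem_unitCube hx hy hs.1 hs.2.le)).trans ?_
    rw [add_sub_cancel_left]
    exact mul_le_mul_of_nonneg_left (norm_smul_le_of_mem hs.1 hs.2.le) (hL0 j)

/-- Second-order Taylor estimate, uniform on the unit cube. -/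
lemma exists_taylor_two {r : ℕ} {f : (Fin r → ℝ) → ℝ} (hf : ContDiff ℝ 3 f) :
    ∃ C : ℝ, 0 ≤ C ∧ ∀ x ∈ unitCube r, ∀ y ∈ unitCube r,
      |f y - f x - ∑ j, (y j - x j) * partialDeriv j f x
        - (1 / 2) * ∑ i, ∑ j, (y i - x i) * (y j - x j) * partialDeriv i (partialDeriv j f) x|
        ≤ C * ‖y - x‖ ^ 3 := by
  choose L hL0 hL using fun j =>
    exists_taylor_one (hf.partialDeriv (m := 2) (by norm_num) j)
  have hsq : ∀ S s : ℝ, HasDerivAt (fun s : ℝ => s ^ 2 * ((1 / 2) * S)) (s * S) s := by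
    intro S s
    have h := (hasDerivAt_pow 2 s).mul_const ((1 / 2) * S)
    have e : ((2 : ℕ) : ℝ) * s ^ (2 - 1) * ((1 / 2) * S) = s * S := by norm_num; ring
    rwa [e] at h
  refine ⟨∑ j, L j, sum_nonneg fun j _ => hL0 j, fun x hx y hy => ?_⟩
  set v := y - x with hv
  have key := norm_image_sub_le_of_norm_deriv_le_segment_01'
    (f := fun s : ℝ => f (x + s • v) - s * ∑ j, v j * partialDeriv j f x
      - s ^ 2 * ((1 / 2) * ∑ j, ∑ i, v i * v j * partialDeriv i (partialDeriv j f) x))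
    (f' := fun s => ∑ j, v j * partialDeriv j f (x + s • v) - ∑ j, v j * partialDeriv j f x
      - s * ∑ j, ∑ i, v i * v j * partialDeriv i (partialDeriv j f) x)
    (C := (∑ j, L j) * ‖v‖ ^ 3)
    (fun s _ => (((hasDerivAt_along_line (hf.differentiable (by norm_num)) x v s).sub
      (by simpa using (hasDerivAt_id s).mul_const _)).sub
      (hsq _ s)).hasDerivWithinAt)
    (fun s hs => ?_)
  · have e : x + (1 : ℝ) • v = y := by simp [hv]
    rw [e] at key
    convert key using 1
    rw [Real.norm_eq_abs, sum_comm]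
    congr 1
    simp [hv]
    ring
  · have e : ∑ j, v j * partialDeriv j f (x + s • v) - ∑ j, v j * partialDeriv j f x
        - s * ∑ j, ∑ i, v i * v j * partialDeriv i (partialDeriv j f) x
        = ∑ j, v j * (partialDeriv j f (x + s • v) - partialDeriv j f x
          - ∑ i, ((x + s • v) i - x i) * partialDeriv i (partialDeriv j f) x) := by
      rw [mul_sum, ← sum_sub_distrib, ← sum_sub_distrib]
      refine sum_congr rfl fun j _ => ?_
      rw [mul_sub, mul_sub, mul_sum, mul_sum]
      congr 1
      refine sum_congr rfl fun i _ => ?_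
      simp; ring
    rw [e, sum_mul]
    refine (norm_sum_le _ _).trans (sum_le_sum fun j _ => ?_)
    rw [norm_mul, pow_succ, mul_comm, ← mul_assoc]
    refine mul_le_mul ?_ (norm_le_pi_norm v j) (norm_nonneg _)
      (mul_nonneg (hL0 j) (by positivity))
    refine (hL j x hx _ (add_smul_sub_mem_unitCube hx hy hs.1 hs.2.le)).trans ?_
    rw [add_sub_cancel_left]
    exact mul_le_mul_of_nonneg_left
      (pow_le_pow_left₀ (norm_nonneg _) (norm_smul_le_of_mem hs.1 hs.2.le) 2) (hL0 j)

lemma norm_pow_le_sum {r : ℕ} (v : Fin r → ℝ) {k : ℕ} (hk : Even k) (hk0 : k ≠ 0) :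
    ‖v‖ ^ k ≤ ∑ j, v j ^ k := by
  rcases isEmpty_or_nonempty (Fin r) with h | h
  · simp [Subsingleton.elim v 0, hk0]
  · obtain ⟨j, hj⟩ := Finite.exists_max fun j => ‖v j‖
    have h1 : ‖v‖ ≤ ‖v j‖ := (pi_norm_le_iff_of_nonneg (norm_nonneg _)).2 hj
    calc ‖v‖ ^ k ≤ ‖v j‖ ^ k := pow_le_pow_left₀ (norm_nonneg _) h1 k
      _ = v j ^ k := hk.pow_abs _
      _ ≤ _ := single_le_sum (f := fun j => v j ^ k) (fun _ _ => hk.pow_nonneg _) (mem_univ j)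

lemma mem_unitCube_of_sum_eq_one {r : ℕ} {x : Fin r → ℝ} (hx0 : ∀ j, 0 ≤ x j)
    (hx1 : ∑ j, x j = 1) : x ∈ unitCube r :=
  ⟨hx0, fun j => (single_le_sum (fun i _ => hx0 i) (mem_univ j)).trans_eq hx1⟩

lemma sum_div_eq_one {r N : ℕ} (hN : 1 ≤ N) {α : Fin r → ℕ} (hα : ∑ i, α i = N) :
    ∑ i, (α i : ℝ) / N = 1 := by
  rw [← sum_div, ← Nat.cast_sum, hα]
  exact div_self (by positivity)

lemma abs_multinomialExp_le {r : ℕ} {q : Fin r → ℝ} (hq : ∀ j, 0 ≤ q j) {n : ℕ}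
    {g h : (Fin r → ℕ) → ℝ} (hgh : ∀ α, ∑ i, α i = n → |g α| ≤ h α) :
    |multinomialExp q n g| ≤ multinomialExp q n h := by
  refine abs_le'.2 ⟨multinomialExp_mono hq fun α hα => (le_abs_self _).trans (hgh α hα), ?_⟩
  rw [← neg_one_mul, ← multinomialExp_const_mul]
  exact multinomialExp_mono hq fun α hα => by
    rw [neg_one_mul]; exact (neg_le_abs _).trans (hgh α hα)

lemma abs_rowExp_le {r : ℕ} {P : Matrix (Fin r) (Fin r) ℝ} (hP : ∀ i j, 0 ≤ P i j)
    {n : Fin r → ℕ} {G H : (Fin r → Fin r → ℕ) → ℝ}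
    (hGH : ∀ ξ, (∀ i, ∑ j, ξ i j = n i) → |G ξ| ≤ H ξ) :
    |rowExp P n G| ≤ rowExp P n H := by
  refine abs_le'.2 ⟨rowExp_mono hP fun ξ hξ => (le_abs_self _).trans (hGH ξ hξ), ?_⟩
  rw [← neg_one_mul, ← rowExp_const_mul]
  exact rowExp_mono hP fun ξ hξ => by
    rw [neg_one_mul]; exact (neg_le_abs _).trans (hGH ξ hξ)

/-- The third absolute moment of a rescaled multinomial vector is of order `N ^ (-3 / 2)`. -/
lemma multinomialExp_norm_cube_le {r N : ℕ} (hN : 1 ≤ N) {q : Fin r → ℝ} (hq0 : ∀ j, 0 ≤ q j)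
    (hq : ∑ j, q j = 1) :
    multinomialExp q N (fun α => ‖(fun j => (α j : ℝ) / N) - q‖ ^ 3)
      ≤ 12 * r / (N * Real.sqrt N) := by
  have hN0 : (0 : ℝ) < N := by exact_mod_cast hN
  obtain ⟨s, hs, hsN⟩ : ∃ s : ℝ, 0 < s ∧ s ^ 2 = N :=
    ⟨Real.sqrt N, Real.sqrt_pos.2 hN0, Real.sq_sqrt hN0.le⟩
  have hsqrt : Real.sqrt N = s := by rw [← hsN, Real.sqrt_sq hs.le]
  have hdev : ∀ (α : Fin r → ℕ) j, ((fun j => (α j : ℝ) / N) - q) j = dev q N j α / N := by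
    intro α j
    simp only [Pi.sub_apply, dev]
    field_simp
  have hbound : ∀ α : Fin r → ℕ, ‖(fun j => (α j : ℝ) / N) - q‖ ^ 3
      ≤ ∑ j, ((s / N ^ 4) * dev q N j α ^ 4
        + (1 / (s * N ^ 2)) * (dev q N j α * dev q N j α)) := by
    intro α
    have h4 := norm_pow_le_sum ((fun j => (α j : ℝ) / N) - q) (k := 4) (by decide) (by decide)
    have h2 := norm_pow_le_sum ((fun j => (α j : ℝ) / N) - q) (k := 2) (by decide) (by decide)
    simp only [hdev] at h4 h2
    have hn := norm_nonneg ((fun j => (α j : ℝ) / N) - q)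
    generalize ‖(fun j => (α j : ℝ) / N) - q‖ = a at *
    have h3 : a ^ 3 ≤ s * a ^ 4 + 1 / s * a ^ 2 := by
      have e : s * a ^ 4 + 1 / s * a ^ 2 - a ^ 3 = a ^ 2 / s * ((s * a) ^ 2 - s * a + 1) := by
        field_simp
        ring
      have : 0 ≤ a ^ 2 / s * ((s * a) ^ 2 - s * a + 1) :=
        mul_nonneg (by positivity) (by nlinarith [sq_nonneg (s * a - 1)])
      linarith
    refine h3.trans ((add_le_add (mul_le_mul_of_nonneg_left h4 hs.le)
      (mul_le_mul_of_nonneg_left h2 (by positivity : 0 ≤ 1 / s))).trans_eq ?_)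
    rw [mul_sum, mul_sum, ← sum_add_distrib]
    refine sum_congr rfl fun j _ => ?_
    field_simp
  refine (multinomialExp_mono hq0 fun α _ => hbound α).trans ?_
  rw [multinomialExp_sum]
  have hterm : ∀ j, multinomialExp q N (fun α => (s / N ^ 4) * dev q N j α ^ 4
        + (1 / (s * N ^ 2)) * (dev q N j α * dev q N j α)) ≤ 12 / (N * s) := by
    intro j
    rw [multinomialExp_add, multinomialExp_const_mul, multinomialExp_const_mul,
      multinomialExp_dev_mul_dev hq]
    have h4 := multinomialExp_dev_pow_four_le hq0 hq N j
    have ha1 : q j ≤ 1 := hq ▸ single_le_sum (fun i _ => hq0 i) (mem_univ j)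
    have hv : q j * ((if j = j then 1 else 0) - q j) ≤ 1 := by
      rw [if_pos rfl]; nlinarith [hq0 j]
    calc _ ≤ s / N ^ 4 * (11 * (N : ℝ) ^ 2) + 1 / (s * N ^ 2) * (N * 1) := by gcongr
      _ = 12 / (N * s) := by
        rw [← hsN]; field_simp; norm_num
  refine (sum_le_sum fun j _ => hterm j).trans_eq ?_
  rw [hsqrt]
  simp
  ring

/-- Multinomial sampling has generator `GB`, with rate `N ^ (-1 / 2)` uniformly on the simplex. -/
lemma exists_TOp_estimate {r : ℕ} {f : (Fin r → ℝ) → ℝ} (hf : ContDiff ℝ 3 f) :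
    ∃ C : ℝ, 0 ≤ C ∧ ∀ N : ℕ, 1 ≤ N → ∀ x : Fin r → ℝ, (∀ j, 0 ≤ x j) → ∑ j, x j = 1 →
      |N * (TOp N f x - f x) - GB f x| ≤ C / Real.sqrt N := by
  obtain ⟨C, hC0, hC⟩ := exists_taylor_two hf
  refine ⟨C * (12 * r), by positivity, fun N hN x hx0 hx1 => ?_⟩
  have hN0 : (0 : ℝ) < N := by exact_mod_cast hN
  set R : (Fin r → ℕ) → ℝ := fun α =>
    f (fun i => (α i : ℝ) / N) - f x - ∑ j, ((α j : ℝ) / N - x j) * partialDeriv j f x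
      - (1 / 2) * ∑ i, ∑ j, ((α i : ℝ) / N - x i) * ((α j : ℝ) / N - x j)
        * partialDeriv i (partialDeriv j f) x with hR
  have hdev : ∀ (α : Fin r → ℕ) j, (α j : ℝ) / N - x j = dev x N j α / N := by
    intro α j
    simp only [dev]
    field_simp
  have hdecomp : TOp N f x = multinomialExp x N R + (f x + (0 + GB f x / N)) := by
    have hfun : (fun α : Fin r → ℕ => f fun i => (α i : ℝ) / N) = fun α =>
        R α + (f x + (∑ j, (partialDeriv j f x / N) * dev x N j α
          + ∑ i, ∑ j, (partialDeriv i (partialDeriv j f) x / (2 * N ^ 2))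
            * (dev x N i α * dev x N j α))) := by
      funext α
      have e1 : ∑ j, ((α j : ℝ) / N - x j) * partialDeriv j f x
          = ∑ j, (partialDeriv j f x / N) * dev x N j α :=
        sum_congr rfl fun j _ => by rw [hdev]; ring
      have e2 : (1 / 2) * ∑ i, ∑ j, ((α i : ℝ) / N - x i) * ((α j : ℝ) / N - x j)
          * partialDeriv i (partialDeriv j f) x
          = ∑ i, ∑ j, (partialDeriv i (partialDeriv j f) x / (2 * N ^ 2))
            * (dev x N i α * dev x N j α) := by
        rw [mul_sum]
        refine sum_congr rfl fun i _ => ?_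
        rw [mul_sum]
        refine sum_congr rfl fun j _ => ?_
        rw [hdev, hdev]
        field_simp
      simp only [hR]
      rw [e1, e2]
      ring
    rw [TOp_eq_multinomialExp, hfun, multinomialExp_add, multinomialExp_add,
      multinomialExp_add, multinomialExp_const hx1, multinomialExp_sum, multinomialExp_sum]
    congr 3
    · exact sum_eq_zero fun j _ => by
        rw [multinomialExp_const_mul, multinomialExp_dev hx1, mul_zero]
    · rw [GB, mul_sum, sum_div]
      refine sum_congr rfl fun i _ => ?_
      rw [multinomialExp_sum, mul_sum, sum_div]
      refine sum_congr rfl fun j _ => ?_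
      rw [multinomialExp_const_mul, multinomialExp_dev_mul_dev hx1]
      change _ = 1 / 2 * (x i * ((if i = j then 1 else 0) - x j) *
        partialDeriv i (partialDeriv j f) x) / N
      field_simp
  have hRle : |multinomialExp x N R| ≤ C * (12 * r / (N * Real.sqrt N)) := by
    refine (abs_multinomialExp_le hx0 fun α hα => hC x (mem_unitCube_of_sum_eq_one hx0 hx1) _
      (mem_unitCube_of_sum_eq_one (fun j => by positivity) (sum_div_eq_one hN hα))).trans ?_
    rw [multinomialExp_const_mul]
    exact mul_le_mul_of_nonneg_left (multinomialExp_norm_cube_le hN hx0 hx1) hC0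
  have e : N * (TOp N f x - f x) - GB f x = N * multinomialExp x N R := by
    rw [hdecomp]; field_simp; ring
  rw [e, abs_mul, abs_of_pos hN0]
  refine (mul_le_mul_of_nonneg_left hRle hN0.le).trans_eq ?_
  field_simp

/-- The mean displacement, scaled by `N`, caused by the internal dynamics. -/
def drift {r : ℕ} (M : Matrix (Fin r) (Fin r) ℝ) (x : Fin r → ℝ) (j : Fin r) : ℝ :=
  ∑ i, x i * M i j

lemma GA_eq_sum_drift {r : ℕ} (M : Matrix (Fin r) (Fin r) ℝ) (f : (Fin r → ℝ) → ℝ)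
    (x : Fin r → ℝ) : GA M f x = ∑ j, drift M x j * partialDeriv j f x := by
  simp only [GA, drift, sum_mul]
  exact sum_comm

/-- The empirical measure after the internal dynamics. -/
def empirical {r : ℕ} (N : ℕ) (ξ : Fin r → Fin r → ℕ) (j : Fin r) : ℝ :=
  ((∑ i, ξ i j : ℕ) : ℝ) / N

lemma sum_empirical {r N : ℕ} (hN : 1 ≤ N) {n : Fin r → ℕ} (hn : ∑ i, n i = N)
    {ξ : Fin r → Fin r → ℕ} (hξ : ∀ i, ∑ j, ξ i j = n i) : ∑ j, empirical N ξ j = 1 :=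
  sum_div_eq_one (α := fun j => ∑ i, ξ i j) hN (by rw [sum_comm, sum_congr rfl fun i _ => hξ i, hn])

lemma empirical_nonneg {r : ℕ} (N : ℕ) (ξ : Fin r → Fin r → ℕ) (j : Fin r) :
    0 ≤ empirical N ξ j := by unfold empirical; positivity

lemma empirical_sub {r N : ℕ} (hN : 1 ≤ N) (M : Matrix (Fin r) (Fin r) ℝ) (n : Fin r → ℕ)
    (ξ : Fin r → Fin r → ℕ) (j : Fin r) :
    empirical N ξ j - (n j : ℝ) / N
      = (1 / N) * (totalDev (1 + (N : ℝ)⁻¹ • M) n j ξ + drift M (fun i => (n i : ℝ) / N) j) := by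
  have hN0 : (0 : ℝ) < N := by exact_mod_cast hN
  have h1 : ∑ i, (n i : ℝ) * (1 : Matrix (Fin r) (Fin r) ℝ) i j = n j := by
    simp [Matrix.one_apply]
  have h2 : drift M (fun i => (n i : ℝ) / N) j = ∑ i, (n i : ℝ) * ((N : ℝ)⁻¹ * M i j) :=
    sum_congr rfl fun i _ => by field_simp
  have h3 : totalDev (1 + (N : ℝ)⁻¹ • M) n j ξ = (∑ i, ξ i j : ℕ) - n j
      - drift M (fun i => (n i : ℝ) / N) j := by
    rw [h2, ← h1]
    simp only [totalDev, dev, Matrix.add_apply, Matrix.smul_apply, smul_eq_mul, mul_add,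
      sum_sub_distrib, sum_add_distrib, Nat.cast_sum]
    ring
  rw [h3, empirical]
  field_simp
  ring

lemma abs_drift_le {r : ℕ} {M : Matrix (Fin r) (Fin r) ℝ} {B : ℝ} (hM : ∀ i j, |M i j| ≤ B)
    {x : Fin r → ℝ} (hx0 : ∀ j, 0 ≤ x j) (hx1 : ∑ j, x j = 1) (j : Fin r) :
    |drift M x j| ≤ B := by
  refine (abs_sum_le_sum_abs _ _).trans ?_
  calc ∑ i, |x i * M i j| ≤ ∑ i, x i * B := sum_le_sum fun i _ => by
        rw [abs_mul, abs_of_nonneg (hx0 i)]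
        exact mul_le_mul_of_nonneg_left (hM i j) (hx0 i)
    _ = B := by rw [← sum_mul, hx1, one_mul]

section InternalDynamics

variable {r N : ℕ} {M : Matrix (Fin r) (Fin r) ℝ} {B : ℝ} {n : Fin r → ℕ}

lemma rowExp_empirical_sub (hN : 1 ≤ N) (hP : IsStochastic (1 + (N : ℝ)⁻¹ • M)) (j : Fin r) :
    rowExp (1 + (N : ℝ)⁻¹ • M) n (fun ξ => empirical N ξ j - (n j : ℝ) / N)
      = drift M (fun i => (n i : ℝ) / N) j / N := by
  simp only [empirical_sub hN M]
  rw [rowExp_const_mul, rowExp_add, rowExp_totalDev hP.2, rowExp_const hP.2]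
  ring

/-- The second moment of the displacement by the internal dynamics is of order `N ^ (-2)`. -/
lemma rowExp_norm_sq_le (hN : 1 ≤ N) (hP : IsStochastic (1 + (N : ℝ)⁻¹ • M))
    (hM : ∀ i j, |M i j| ≤ B) (hn : ∑ i, n i = N) :
    rowExp (1 + (N : ℝ)⁻¹ • M) n (fun ξ => ‖empirical N ξ - fun i => (n i : ℝ) / N‖ ^ 2)
      ≤ r * (B + B ^ 2) / N ^ 2 := by
  have hN0 : (0 : ℝ) < N := by exact_mod_cast hN
  set P := 1 + (N : ℝ)⁻¹ • M with hPdef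
  have hP1 : ∀ i j, P i j ≤ 1 := fun i j =>
    (single_le_sum (fun k _ => hP.1 i k) (mem_univ j)).trans_eq (hP.2 i)
  have hPv : ∀ i j, P i j * (1 - P i j) ≤ B / N := by
    intro i j
    have h0 := hP.1 i j
    have h1 := hP1 i j
    have hb : |(N : ℝ)⁻¹ * M i j| ≤ B / N := by
      rw [abs_mul, abs_of_pos (inv_pos.2 hN0), div_eq_inv_mul]
      exact mul_le_mul_of_nonneg_left (hM i j) (inv_pos.2 hN0).le
    have hb' := abs_le.1 hb
    by_cases hij : i = j
    · have : P i j = 1 + (N : ℝ)⁻¹ * M i j := by simp [hPdef, hij]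
      nlinarith
    · have : P i j = (N : ℝ)⁻¹ * M i j := by simp [hPdef, Matrix.one_apply_ne hij]
      nlinarith
  have hn' : ∑ i, (n i : ℝ) = N := by rw [← Nat.cast_sum, hn]
  have hterm : ∀ j, rowExp P n (fun ξ => (empirical N ξ j - (n j : ℝ) / N) ^ 2)
      ≤ (B + B ^ 2) / N ^ 2 := by
    intro j
    have hd := abs_drift_le hM (fun j => by positivity : ∀ j, 0 ≤ (n j : ℝ) / N)
      (sum_div_eq_one hN hn) j
    have hfun : (fun ξ => (empirical N ξ j - (n j : ℝ) / N) ^ 2) = fun ξ =>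
        (1 / (N : ℝ) ^ 2) * (totalDev P n j ξ ^ 2
          + ((2 * drift M (fun i => (n i : ℝ) / N) j) * totalDev P n j ξ
            + drift M (fun i => (n i : ℝ) / N) j ^ 2)) := by
      funext ξ
      rw [empirical_sub hN M, ← hPdef]
      field_simp
      ring
    rw [hfun, rowExp_const_mul, rowExp_add, rowExp_add, rowExp_const_mul, rowExp_const hP.2,
      rowExp_totalDev hP.2, rowExp_totalDev_sq hP.2]
    have h1 : ∑ i, (n i : ℝ) * (P i j * (1 - P i j)) ≤ B := by
      calc _ ≤ ∑ i, (n i : ℝ) * (B / N) := sum_le_sum fun i _ =>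
            mul_le_mul_of_nonneg_left (hPv i j) (Nat.cast_nonneg _)
        _ = B := by rw [← sum_mul, hn']; field_simp
    have h2 : drift M (fun i => (n i : ℝ) / N) j ^ 2 ≤ B ^ 2 := by
      rw [← sq_abs]; exact pow_le_pow_left₀ (abs_nonneg _) hd 2
    rw [div_eq_mul_one_div (B + B ^ 2), mul_comm (B + B ^ 2)]
    refine mul_le_mul_of_nonneg_left ?_ (by positivity)
    linarith
  refine (rowExp_mono hP.1 fun ξ _ => norm_pow_le_sum _ (by decide) (by decide)).trans ?_
  rw [rowExp_sum]
  refine (sum_le_sum fun j _ => hterm j).trans_eq ?_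
  simp
  ring

lemma empirical_mem_unitCube (hN : 1 ≤ N) (hn : ∑ i, n i = N)
    {ξ : Fin r → Fin r → ℕ} (hξ : ∀ i, ∑ j, ξ i j = n i) : empirical N ξ ∈ unitCube r :=
  mem_unitCube_of_sum_eq_one (empirical_nonneg N ξ) (sum_empirical hN hn hξ)

lemma grid_mem_unitCube (hN : 1 ≤ N) (hn : ∑ i, n i = N) :
    (fun i => (n i : ℝ) / N) ∈ unitCube r :=
  mem_unitCube_of_sum_eq_one (fun _ => by positivity) (sum_div_eq_one hN hn)

/-- The internal dynamics has generator `GA`, with rate `N ^ (-1)` given a first-order Taylor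
bound with constant `C`. -/
lemma abs_SOp_sub_GA_le {f : (Fin r → ℝ) → ℝ} {C : ℝ} (hC0 : 0 ≤ C)
    (hC : ∀ x ∈ unitCube r, ∀ y ∈ unitCube r,
      |f y - f x - ∑ j, (y j - x j) * partialDeriv j f x| ≤ C * ‖y - x‖ ^ 2)
    (hN : 1 ≤ N) (hP : IsStochastic (1 + (N : ℝ)⁻¹ • M))
    (hM : ∀ i j, |M i j| ≤ B) (hn : ∑ i, n i = N) :
    |N * (SOp N (1 + (N : ℝ)⁻¹ • M) f n - f fun i => (n i : ℝ) / N)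
      - GA M f fun i => (n i : ℝ) / N| ≤ C * (r * (B + B ^ 2)) / N := by
  have hN0 : (0 : ℝ) < N := by exact_mod_cast hN
  set x : Fin r → ℝ := fun i => (n i : ℝ) / N with hx
  set P := 1 + (N : ℝ)⁻¹ • M with hPdef
  set R : (Fin r → Fin r → ℕ) → ℝ := fun ξ => f (empirical N ξ) - f x
    - ∑ j, (empirical N ξ j - x j) * partialDeriv j f x with hR
  have hdecomp : SOp N P f n = rowExp P n R + (f x + GA M f x / N) := by
    have hfun : (fun ξ => f (empirical N ξ)) = fun ξ => R ξ + (f x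
        + ∑ j, partialDeriv j f x * (empirical N ξ j - (n j : ℝ) / N)) := by
      funext ξ
      simp only [hR, mul_comm (partialDeriv _ f x)]
      ring
    rw [SOp_eq_rowExp]
    change rowExp P n (fun ξ => f (empirical N ξ)) = _
    rw [hfun, rowExp_add, rowExp_add, rowExp_const hP.2, rowExp_sum, GA_eq_sum_drift, sum_div]
    congr 2
    refine sum_congr rfl fun j _ => ?_
    rw [rowExp_const_mul, rowExp_empirical_sub hN hP]
    ring
  have hRle : |rowExp P n R| ≤ C * (r * (B + B ^ 2) / N ^ 2) := by
    refine (abs_rowExp_le hP.1 fun ξ hξ => hC x (grid_mem_unitCube hN hn) _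
      (empirical_mem_unitCube hN hn hξ)).trans ?_
    rw [rowExp_const_mul]
    exact mul_le_mul_of_nonneg_left (rowExp_norm_sq_le hN hP hM hn) hC0
  have e : N * (SOp N P f n - f x) - GA M f x = N * rowExp P n R := by
    rw [hdecomp]; field_simp; ring
  rw [e, abs_mul, abs_of_pos hN0]
  refine (mul_le_mul_of_nonneg_left hRle hN0.le).trans_eq ?_
  field_simp

/-- The internal dynamics moves the value of a Lipschitz function by `O(1 / N)`. -/
lemma abs_SOp_sub_le {g : (Fin r → ℝ) → ℝ} {C : ℝ} (hC0 : 0 ≤ C)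
    (hC : ∀ x ∈ unitCube r, ∀ y ∈ unitCube r, |g y - g x| ≤ C * ‖y - x‖)
    (hN : 1 ≤ N) (hP : IsStochastic (1 + (N : ℝ)⁻¹ • M))
    (hM : ∀ i j, |M i j| ≤ B) (hn : ∑ i, n i = N) :
    |SOp N (1 + (N : ℝ)⁻¹ • M) g n - g fun i => (n i : ℝ) / N|
      ≤ C * (r * (B + B ^ 2) + 1) / N := by
  have hN0 : (0 : ℝ) < N := by exact_mod_cast hN
  set x : Fin r → ℝ := fun i => (n i : ℝ) / N with hx
  set P := 1 + (N : ℝ)⁻¹ • M with hPdef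
  have e : SOp N P g n - g x = rowExp P n fun ξ => g (empirical N ξ) + -g x := by
    rw [rowExp_add, rowExp_const hP.2]
    rfl
  rw [e]
  refine (abs_rowExp_le (H := fun ξ => C * (N * ‖empirical N ξ - x‖ ^ 2 + 1 / N)) hP.1
    fun ξ hξ => ?_).trans ?_
  · refine (hC x (grid_mem_unitCube hN hn) _ (empirical_mem_unitCube hN hn hξ)).trans
      (mul_le_mul_of_nonneg_left ?_ hC0)
    generalize ‖empirical N ξ - x‖ = a
    have : N * a ^ 2 + 1 / N - a = 1 / N * ((N * a) ^ 2 - N * a + 1) := by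
      field_simp
      ring
    have h2 : 0 ≤ 1 / (N : ℝ) * ((N * a) ^ 2 - N * a + 1) :=
      mul_nonneg (by positivity) (by nlinarith [sq_nonneg (N * a - 1)])
    linarith
  · rw [rowExp_const_mul, rowExp_add, rowExp_const_mul, rowExp_const hP.2]
    calc _ ≤ C * (N * (r * (B + B ^ 2) / N ^ 2) + 1 / N) := by
          gcongr
          exact rowExp_norm_sq_le hN hP hM hn
      _ = _ := by field_simp

lemma abs_UOp_sub_SOp_GB_le {f : (Fin r → ℝ) → ℝ} {δ : ℝ}
    (hT : ∀ x : Fin r → ℝ, (∀ j, 0 ≤ x j) → ∑ j, x j = 1 →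
      |N * (TOp N f x - f x) - GB f x| ≤ δ)
    (hN : 1 ≤ N) (hP : IsStochastic (1 + (N : ℝ)⁻¹ • M)) (hn : ∑ i, n i = N) :
    |N * (UOp N (1 + (N : ℝ)⁻¹ • M) f n - SOp N (1 + (N : ℝ)⁻¹ • M) f n)
      - SOp N (1 + (N : ℝ)⁻¹ • M) (GB f) n| ≤ δ := by
  set P := 1 + (N : ℝ)⁻¹ • M with hPdef
  have e : N * (UOp N P f n - SOp N P f n) - SOp N P (GB f) n = rowExp P n fun ξ =>
      N * (TOp N f (empirical N ξ) - f (empirical N ξ)) - GB f (empirical N ξ) := by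
    have hemp : ∀ ξ : Fin r → Fin r → ℕ,
        empirical N ξ = fun j => ((∑ i, ξ i j : ℕ) : ℝ) / N := fun _ => rfl
    simp only [UOp, SOp, rowExp, hemp, mul_sub, sum_sub_distrib, mul_sum]
    congr 2 <;> exact sum_congr rfl fun _ _ => by ring
  rw [e]
  refine (abs_rowExp_le (H := fun _ => δ) hP.1 fun ξ hξ =>
    hT _ (empirical_nonneg N ξ) (sum_empirical hN hn hξ)).trans_eq (rowExp_const hP.2 n δ)

end InternalDynamics

lemma ContDiff.GB {r : ℕ} {f : (Fin r → ℝ) → ℝ} (hf : ContDiff ℝ 3 f) : ContDiff ℝ 1 (GB f) := by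
  have h : ∀ i j, ContDiff ℝ 1 (_root_.partialDeriv i (_root_.partialDeriv j f)) := fun i j =>
    (hf.partialDeriv (m := 2) (by norm_num) j).partialDeriv (by norm_num) i
  refine contDiff_const.mul (ContDiff.sum fun i _ => ContDiff.sum fun j _ => ?_)
  exact ((contDiff_apply ℝ ℝ i).mul (contDiff_const.sub (contDiff_apply ℝ ℝ j))).mul (h i j)

/-- `GA` depends continuously on the matrix, uniformly on the unit cube. -/
lemma exists_abs_GA_sub_le {r : ℕ} {f : (Fin r → ℝ) → ℝ} (hf : ContDiff ℝ 1 f) :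
    ∃ C : ℝ, 0 ≤ C ∧ ∀ (M L : Matrix (Fin r) (Fin r) ℝ) (η : ℝ), (∀ i j, |M i j - L i j| ≤ η) →
      ∀ x : Fin r → ℝ, (∀ j, 0 ≤ x j) → ∑ j, x j = 1 → |GA M f x - GA L f x| ≤ C * η := by
  choose D hD0 hD using fun j =>
    exists_bound_unitCube (hf.partialDeriv (m := 0) (by norm_num) j).continuous
  refine ⟨∑ j, D j, sum_nonneg fun j _ => hD0 j, fun M L η hη x hx0 hx1 => ?_⟩
  have e : GA M f x - GA L f x = ∑ j, drift (M - L) x j * partialDeriv j f x := by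
    simp only [GA_eq_sum_drift, drift, ← sum_sub_distrib, ← sub_mul, ← mul_sub, Matrix.sub_apply]
  rw [e, sum_mul]
  refine (abs_sum_le_sum_abs _ _).trans (sum_le_sum fun j _ => ?_)
  rw [abs_mul, mul_comm]
  exact mul_le_mul (hD j x (mem_unitCube_of_sum_eq_one hx0 hx1))
    (abs_drift_le (M := M - L) hη hx0 hx1 j) (abs_nonneg _) (hD0 j)

/-- Generator convergence for internal dynamics followed by multinomial sampling:
for every C³ function `f` and every `t ≥ 0`,
`lim_N sup_(p ∈ K_N) |N(U_(N,[Nt])f(p) − f(p)) − (G_A(t)f(p) + G_B f(p))| = 0`. -/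
theorem combined_generator_convergence
    (r : ℕ) (hr : 2 ≤ r)
    (A : ℕ → ℝ → Matrix (Fin r) (Fin r) ℝ)
    (Alim : ℝ → Matrix (Fin r) (Fin r) ℝ)
    (hQ : ∀ N : ℕ, 1 ≤ N → ∀ t : ℝ, 0 ≤ t → IsQMatrix (A N t))
    (hstepwise : ∀ N : ℕ, 1 ≤ N → ∀ k : ℕ, ∀ t : ℝ,
      (k : ℝ) / N ≤ t → t < ((k : ℝ) + 1) / N → A N t = A N ((k : ℝ) / N))
    (hQlim : ∀ t : ℝ, 0 ≤ t → IsQMatrix (Alim t))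
    (hcadlag_right : ∀ t : ℝ, 0 ≤ t → ContinuousWithinAt Alim (Set.Ici t) t)
    (hcadlag_left : ∀ t : ℝ, 0 < t →
      ∃ L, Filter.Tendsto Alim (nhdsWithin t (Set.Iio t)) (nhds L))
    (hstoch : ∀ N : ℕ, 1 ≤ N → ∀ k : ℕ,
      IsStochastic (1 + ((N : ℝ))⁻¹ • A N ((k : ℝ) / N)))
    (hconv : Filter.Tendsto (fun N => dU (A N) Alim) Filter.atTop (nhds 0))
    (f : (Fin r → ℝ) → ℝ) (hf : ContDiff ℝ 3 f) (t : ℝ) (ht : 0 ≤ t) :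
    ∀ ε > 0, ∃ N₀ : ℕ, ∀ N : ℕ, N₀ ≤ N → 1 ≤ N →
      ∀ n : Fin r → ℕ, ∑ i, n i = N →
        |(N : ℝ) * (UOp N (1 + ((N : ℝ))⁻¹ • A N ((⌊(N : ℝ) * t⌋₊ : ℝ) / N)) f n
              - f fun i => (n i : ℝ) / N)
          - (GA (Alim t) f (fun i => (n i : ℝ) / N)
              + GB f (fun i => (n i : ℝ) / N))| < ε := by
  intro ε hε
  obtain ⟨C₁, hC₁0, hC₁⟩ := exists_TOp_estimate hf
  obtain ⟨C₂, hC₂0, hC₂⟩ := exists_lipschitz_unitCube hf.GB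
  obtain ⟨C₃, hC₃0, hC₃⟩ := exists_taylor_one (hf.of_le (by norm_num : (2 : WithTop ℕ∞) ≤ 3))
  obtain ⟨C₄, hC₄0, hC₄⟩ := exists_abs_GA_sub_le (hf.of_le (by norm_num : (1 : WithTop ℕ∞) ≤ 3))
  set B : ℝ := frobNorm (Alim t) + 1 with hB
  set η : ℝ := min 1 (ε / (2 * (C₄ + 1))) with hη
  have hη0 : 0 < η := lt_min one_pos (by positivity)
  have hηC : C₄ * η < ε / 2 := by
    have h1 : C₄ * η ≤ C₄ * (ε / (2 * (C₄ + 1))) :=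
      mul_le_mul_of_nonneg_left (min_le_right _ _) hC₄0
    have h2 : C₄ * (ε / (2 * (C₄ + 1))) < ε / 2 := by
      rw [← mul_div_assoc, div_lt_div_iff₀ (by positivity) two_pos]
      nlinarith
    exact h1.trans_lt h2
  have hlim : Tendsto (fun N : ℕ => C₁ / Real.sqrt N + C₂ * (r * (B + B ^ 2) + 1) / N
      + C₃ * (r * (B + B ^ 2)) / N) atTop (𝓝 0) := by
    have hsqrt : Tendsto (fun N : ℕ => C₁ / Real.sqrt N) atTop (𝓝 0) :=
      (Real.tendsto_sqrt_atTop.comp tendsto_natCast_atTop_atTop).const_div_atTop C₁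
    simpa using (hsqrt.add (tendsto_const_div_atTop_nhds_zero_nat _)).add
      (tendsto_const_div_atTop_nhds_zero_nat _)
  obtain ⟨N₀, hN₀⟩ := eventually_atTop.1 ((hlim.eventually (gt_mem_nhds (half_pos hε))).and
    (eventually_abs_sub_lt_of_dU hconv ht hη0))
  refine ⟨N₀, fun N hNN₀ hN n hn => ?_⟩
  obtain ⟨hsmall, hclose⟩ := hN₀ N hNN₀
  have hP := hstoch N hN ⌊(N : ℝ) * t⌋₊
  rw [stepwise_eq_floor hN (hstepwise N hN) ht] at hP ⊢
  have hM : ∀ i j, |A N t i j| ≤ B := fun i j => by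
    have h1 := abs_sub_abs_le_abs_sub (A N t i j) (Alim t i j)
    have h2 := abs_apply_le_frobNorm (Alim t) i j
    have h3 := (hclose i j).le.trans (min_le_left _ _)
    linarith
  have hx1 := sum_div_eq_one hN hn
  have h1 := abs_le.1 (abs_UOp_sub_SOp_GB_le (hC₁ N hN) hN hP hn)
  have h2 := abs_le.1 (abs_SOp_sub_le hC₂0 hC₂ hN hP hM hn)
  have h3 := abs_le.1 (abs_SOp_sub_GA_le hC₃0 hC₃ hN hP hM hn)
  have h4 := abs_le.1 (hC₄ _ _ η (fun i j => (hclose i j).le) (fun i => (n i : ℝ) / N)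
    (fun _ => by positivity) hx1)
  refine abs_lt.2 ⟨?_, ?_⟩ <;> linarith [h1.1, h1.2, h2.1, h2.2, h3.1, h3.2, h4.1, h4.2]
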